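/- arXiv:1906.03604 — 6 statements merged into one kernel-verified Lean document; each statement's English description precedes it below -/
import Mathlib

section
/- Let k be a positive integer and ρ1, ρ2 ∈ (-1,1). The (k+1)×(k+1) bordered equicorrelation matrix Σ_{ρ1,ρ2}^{[k,1]} is positive definite if and only if k·ρ1² - 1 < (k-1)·ρ2. -/
open Matrix

/-- The k×k equicorrelation matrix: 1 on the diagonal, ρ2 off the diagonal. -/
def eqCor (k : ℕ) (ρ2 : ℝ) : Matrix (Fin k) (Fin k) ℝ :=
  Matrix.of fun i j => if i = j then 1 else ρ2

/-- The (k+1)×(k+1) bordered equicorrelation matrix: top-left entry 1, remaining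
first-row/first-column entries ρ1, lower-right k×k block equal to `eqCor k ρ2`. -/
def borderedEqCor (k : ℕ) (ρ1 ρ2 : ℝ) : Matrix (Fin (k + 1)) (Fin (k + 1)) ℝ :=
  Matrix.of fun i j =>
    if i = j then 1 else if i = 0 ∨ j = 0 then ρ1 else ρ2

theorem borderedEqCor_isHermitian (k : ℕ) (ρ1 ρ2 : ℝ) :
    (borderedEqCor k ρ1 ρ2).IsHermitian := by
  ext i j
  simp [borderedEqCor, eq_comm, or_comm]

/-- The quadratic form of the bordered equicorrelation matrix, in terms of the first coordinate
and of the sum and the sum of squares of the other ones. -/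
theorem dotProduct_borderedEqCor_mulVec (k : ℕ) (ρ1 ρ2 : ℝ) (x : Fin (k + 1) → ℝ) :
    star x ⬝ᵥ (borderedEqCor k ρ1 ρ2 *ᵥ x) =
      x 0 ^ 2 + 2 * ρ1 * x 0 * (∑ i : Fin k, x i.succ) +
        (1 - ρ2) * (∑ i : Fin k, x i.succ ^ 2) + ρ2 * (∑ i : Fin k, x i.succ) ^ 2 := by
  have hrow : ∀ i : Fin k, (borderedEqCor k ρ1 ρ2 *ᵥ x) i.succ =
      ρ1 * x 0 + ((1 - ρ2) * x i.succ + ρ2 * ∑ j : Fin k, x j.succ) := by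
    intro i
    have hentry : ∀ j : Fin k, borderedEqCor k ρ1 ρ2 i.succ j.succ * x j.succ =
        (if i = j then (1 - ρ2) * x j.succ else 0) + ρ2 * x j.succ := by
      intro j
      by_cases h : i = j
      · simp [borderedEqCor, h]; ring
      · simp [borderedEqCor, h]
    have hcol : borderedEqCor k ρ1 ρ2 i.succ 0 = ρ1 := by simp [borderedEqCor]
    simp only [mulVec, dotProduct, Fin.sum_univ_succ, hentry, hcol, Finset.sum_add_distrib,
      Finset.sum_ite_eq, Finset.mem_univ, if_true, Finset.mul_sum]
  have hfirst : (borderedEqCor k ρ1 ρ2 *ᵥ x) 0 = x 0 + ρ1 * ∑ j : Fin k, x j.succ := by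
    simp [mulVec, dotProduct, Fin.sum_univ_succ, borderedEqCor, Finset.mul_sum,
      (Fin.succ_ne_zero _).symm]
  have hrest : ∀ c : ℝ, ∑ i : Fin k, x i.succ * (ρ1 * x 0 + ((1 - ρ2) * x i.succ + c)) =
      (∑ i : Fin k, x i.succ) * (ρ1 * x 0 + c) + (1 - ρ2) * ∑ i : Fin k, x i.succ ^ 2 := by
    intro c
    rw [Finset.sum_mul, Finset.mul_sum, ← Finset.sum_add_distrib]
    exact Finset.sum_congr rfl fun i _ => by ring
  rw [dotProduct, Fin.sum_univ_succ]
  simp only [hrow, hfirst, star_trivial, hrest]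
  ring

theorem stmt_8 (k : ℕ) (hk : 0 < k) (ρ1 ρ2 : ℝ)
    (h1 : -1 < ρ1) (h1' : ρ1 < 1) (h2 : -1 < ρ2) (h2' : ρ2 < 1) :
    (borderedEqCor k ρ1 ρ2).PosDef ↔ (k : ℝ) * ρ1 ^ 2 - 1 < ((k : ℝ) - 1) * ρ2 := by
  have hk' : (0 : ℝ) < k := by exact_mod_cast hk
  constructor
  · intro h
    have hx : (Fin.cons (-(ρ1 * k)) (fun _ => 1) : Fin (k + 1) → ℝ) ≠ 0 := by
      intro h0
      have hone := congrFun h0 (Fin.succ ⟨0, hk⟩)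
      rw [Fin.cons_succ] at hone
      exact one_ne_zero hone
    have hpos := h.dotProduct_mulVec_pos hx
    rw [dotProduct_borderedEqCor_mulVec] at hpos
    simp only [Fin.cons_zero, Fin.cons_succ, one_pow, Finset.sum_const, Finset.card_univ,
      Fintype.card_fin, nsmul_eq_mul, mul_one] at hpos
    have hfactor : 0 < (k : ℝ) * (1 + (k - 1) * ρ2 - k * ρ1 ^ 2) := by linarith
    linarith [pos_of_mul_pos_right hfactor hk'.le]
  · intro h
    refine PosDef.of_dotProduct_mulVec_pos (borderedEqCor_isHermitian k ρ1 ρ2) fun x hx => ?_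
    rw [dotProduct_borderedEqCor_mulVec]
    have hcs : (∑ i : Fin k, x i.succ) ^ 2 ≤ k * ∑ i : Fin k, x i.succ ^ 2 := by
      simpa using sq_sum_le_card_mul_sum_sq (s := Finset.univ) (f := fun i : Fin k => x i.succ)
    have hq : 0 ≤ ∑ i : Fin k, x i.succ ^ 2 := Finset.sum_nonneg fun i _ => sq_nonneg _
    have hx0 : ∑ i : Fin k, x i.succ ^ 2 = 0 → x 0 ≠ 0 := by
      intro hzero h0
      rw [Finset.sum_eq_zero_iff_of_nonneg fun i _ => sq_nonneg _] at hzero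
      refine hx (funext fun i => ?_)
      refine Fin.cases h0 (fun j => ?_) i
      simpa using hzero j (Finset.mem_univ j)
    generalize ∑ i : Fin k, x i.succ = s at *
    generalize ∑ i : Fin k, x i.succ ^ 2 = q at *
    have hD : 0 < 1 + ((k : ℝ) - 1) * ρ2 - k * ρ1 ^ 2 := by linarith
    have hr : 0 < 1 - ρ2 := by linarith
    refine pos_of_mul_pos_right (a := (k : ℝ)) ?_ hk'.le
    have hsquares : (k : ℝ) * (x 0 ^ 2 + 2 * ρ1 * x 0 * s + (1 - ρ2) * q + ρ2 * s ^ 2) =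
        k * (x 0 + ρ1 * s) ^ 2 + (1 - ρ2) * (k * q - s ^ 2) +
          s ^ 2 * (1 + ((k : ℝ) - 1) * ρ2 - k * ρ1 ^ 2) := by ring
    rw [hsquares]
    have hnonneg : 0 ≤ (1 - ρ2) * (k * q - s ^ 2) := mul_nonneg hr.le (by linarith)
    by_cases hs : s = 0
    · subst hs
      rcases hq.eq_or_lt with hq0 | hq0
      · have := hx0 hq0.symm
        subst hq0
        simp only [mul_zero, add_zero, ne_eq, OfNat.ofNat_ne_zero, not_false_eq_true, zero_pow,
          sub_zero, zero_mul]
        positivity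
      · have := mul_pos hr (mul_pos hk' hq0)
        simp only [mul_zero, add_zero, ne_eq, OfNat.ofNat_ne_zero, not_false_eq_true, zero_pow,
          sub_zero, zero_mul]
        positivity
    · positivity
end

section
/- Let k_1, …, k_z be positive integers and ρ1, ρ2 ∈ (-1,1). Then the bordered equicorrelation matrices Σ_{ρ1,ρ2}^{[k_1,1]}, …, Σ_{ρ1,ρ2}^{[k_z,1]} are all positive definite if and only if L_{ρ1,1}(max{k_1,…,k_z}) < ρ2 < 1, where L_{ρ1,1}(k) = (k·ρ1² - 1)/(k-1) for k > 1 and L_{ρ1,1}(1) = -1. -/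
open Matrix

/-- `L ρ1 k = (k·ρ1² - 1)/(k-1)` for `k > 1`, and `-1` for `k = 1`. -/
noncomputable def L (ρ1 : ℝ) (k : ℕ) : ℝ :=
  if 1 < k then ((k : ℝ) * ρ1 ^ 2 - 1) / ((k : ℝ) - 1) else -1

/-- The quadratic form of the bordered equicorrelation matrix, with the square in the first
coordinate completed. -/
theorem borderedEqCor_dotProduct_mulVec (k : ℕ) (ρ1 ρ2 : ℝ) (x : Fin (k + 1) → ℝ) :
    x ⬝ᵥ (borderedEqCor k ρ1 ρ2 *ᵥ x) =
      (x 0 + ρ1 * ∑ i : Fin k, x i.succ) ^ 2 + (1 - ρ2) * ∑ i : Fin k, x i.succ ^ 2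
        + (ρ2 - ρ1 ^ 2) * (∑ i : Fin k, x i.succ) ^ 2 := by
  have hrow (i : Fin k) : (borderedEqCor k ρ1 ρ2 *ᵥ x) i.succ =
      ρ1 * x 0 + (1 - ρ2) * x i.succ + ρ2 * ∑ j : Fin k, x j.succ := by
    have hentry (j : Fin k) : borderedEqCor k ρ1 ρ2 i.succ j.succ * x j.succ =
        (if i = j then (1 - ρ2) * x j.succ else 0) + ρ2 * x j.succ := by
      by_cases h : i = j <;> simp [borderedEqCor, h]
      ring
    rw [Matrix.mulVec, dotProduct, Fin.sum_univ_succ]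
    simp only [hentry, Finset.sum_add_distrib, ← Finset.mul_sum]
    simp [borderedEqCor, add_assoc]
  have hzero : (borderedEqCor k ρ1 ρ2 *ᵥ x) 0 = x 0 + ρ1 * ∑ j : Fin k, x j.succ := by
    rw [Matrix.mulVec, dotProduct, Fin.sum_univ_succ, Finset.mul_sum]
    simp [borderedEqCor, (Fin.succ_ne_zero _).symm]
  rw [dotProduct, Fin.sum_univ_succ, hzero]
  have hterm (i : Fin k) : x i.succ * (borderedEqCor k ρ1 ρ2 *ᵥ x) i.succ =
      (ρ1 * x 0 + ρ2 * ∑ j : Fin k, x j.succ) * x i.succ + (1 - ρ2) * x i.succ ^ 2 := by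
    rw [hrow]
    ring
  simp only [hterm, Finset.sum_add_distrib, ← Finset.mul_sum]
  ring

theorem borderedEqCor_posDef_iff {k : ℕ} (hk : 0 < k) {ρ1 ρ2 : ℝ} (h : ρ2 < 1) :
    (borderedEqCor k ρ1 ρ2).PosDef ↔ 0 < 1 - ρ2 + k * (ρ2 - ρ1 ^ 2) := by
  have hk' : (0 : ℝ) < k := by exact_mod_cast hk
  rw [Matrix.posDef_iff_dotProduct_mulVec]
  simp only [star_trivial, borderedEqCor_dotProduct_mulVec, borderedEqCor_isHermitian, true_and]
  constructor
  · intro hpos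
    have hx : (Fin.cons (-(ρ1 * k)) fun _ => 1 : Fin (k + 1) → ℝ) ≠ 0 := fun h0 =>
      one_ne_zero (α := ℝ) (congrFun h0 (Fin.succ ⟨0, hk⟩))
    have := hpos hx
    simp only [Fin.cons_zero, Fin.cons_succ, one_pow, Finset.sum_const, Finset.card_univ,
      Fintype.card_fin, nsmul_eq_mul, mul_one] at this
    refine pos_of_mul_pos_right (a := (k : ℝ)) ?_ hk'.le
    linarith
  · intro hc x hx
    set S := ∑ i : Fin k, x i.succ with hS
    set Q := ∑ i : Fin k, x i.succ ^ 2 with hQ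
    have hCS : S ^ 2 ≤ k * Q := by
      simpa using sq_sum_le_card_mul_sum_sq (s := Finset.univ) (f := fun i : Fin k => x i.succ)
    have hQ0 : 0 ≤ Q := Finset.sum_nonneg fun i _ => sq_nonneg _
    have hid : k * ((x 0 + ρ1 * S) ^ 2 + (1 - ρ2) * Q + (ρ2 - ρ1 ^ 2) * S ^ 2) =
        k * (x 0 + ρ1 * S) ^ 2 + (1 - ρ2) * (k * Q - S ^ 2)
          + (1 - ρ2 + k * (ρ2 - ρ1 ^ 2)) * S ^ 2 := by ring
    refine pos_of_mul_pos_right (a := (k : ℝ)) ?_ hk'.le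
    rw [hid]
    have hA : 0 ≤ k * (x 0 + ρ1 * S) ^ 2 := by positivity
    have hB : 0 ≤ (1 - ρ2) * (k * Q - S ^ 2) := mul_nonneg (by linarith) (by linarith)
    rcases eq_or_ne S 0 with hS0 | hS0
    · rw [hS0] at hA hB ⊢
      rcases hQ0.eq_or_lt with hQz | hQpos
      · have hsucc (i : Fin k) : x i.succ = 0 := by
          have := (Finset.sum_eq_zero_iff_of_nonneg
            (fun i _ => sq_nonneg (x (Fin.succ i)))).1 hQz.symm i (Finset.mem_univ i)
          exact pow_eq_zero_iff two_ne_zero |>.1 this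
        have h0 : x 0 ≠ 0 := fun h0 => hx (funext fun i => Fin.cases h0 hsucc i)
        have : 0 < k * (x 0 + ρ1 * 0) ^ 2 := by
          rw [mul_zero, add_zero]
          positivity
        linarith
      · have : 0 < (1 - ρ2) * (k * Q) := mul_pos (by linarith) (by positivity)
        linarith
    · have : 0 < (1 - ρ2 + k * (ρ2 - ρ1 ^ 2)) * S ^ 2 := by positivity
      linarith

theorem L_lt_iff {k : ℕ} (hk : 0 < k) {ρ1 ρ2 : ℝ} (h1 : -1 < ρ1) (h1' : ρ1 < 1)
    (h2 : -1 < ρ2) : L ρ1 k < ρ2 ↔ 0 < 1 - ρ2 + k * (ρ2 - ρ1 ^ 2) := by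
  unfold L
  split_ifs with h
  · have hk1 : (0 : ℝ) < k - 1 := sub_pos.2 (by exact_mod_cast h)
    rw [div_lt_iff₀ hk1]
    constructor <;> intro <;> linarith
  · obtain rfl : k = 1 := by omega
    refine iff_of_true h2 ?_
    push_cast
    nlinarith

theorem stmt_9 (z : ℕ) (hz : 0 < z) (ks : Fin z → ℕ) (hks : ∀ i, 0 < ks i)
    (ρ1 ρ2 : ℝ) (h1 : -1 < ρ1) (h1' : ρ1 < 1) (h2 : -1 < ρ2) (h2' : ρ2 < 1) :
    (∀ i, (borderedEqCor (ks i) ρ1 ρ2).PosDef)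
      ↔ (L ρ1 (Finset.univ.sup ks) < ρ2 ∧ ρ2 < 1) := by
  obtain ⟨m, -, hm⟩ := Finset.exists_mem_eq_sup Finset.univ ⟨⟨0, hz⟩, Finset.mem_univ _⟩ ks
  rw [hm, L_lt_iff (hks m) h1 h1' h2, and_iff_left h2']
  simp only [fun i => borderedEqCor_posDef_iff (ρ1 := ρ1) (hks i) h2']
  refine ⟨fun h => h m, fun h i => ?_⟩
  have hle : (ks i : ℝ) ≤ ks m := by
    exact_mod_cast hm ▸ Finset.le_sup (f := ks) (Finset.mem_univ i)
  rcases le_total 0 (ρ2 - ρ1 ^ 2) with hs | hs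
  · have : 0 ≤ (ks i : ℝ) * (ρ2 - ρ1 ^ 2) := by positivity
    linarith
  · linarith [mul_le_mul_of_nonpos_right hle hs]
end

section
/- Let ρ1, ρ2 ∈ (-1,1) satisfy ρ1² < ρ2 < 1. Then for every positive integer k, the (k+1)×(k+1) bordered equicorrelation matrix Σ_{ρ1,ρ2}^{[k,1]} is positive definite. -/
open Matrix

theorem eqCor_mulVec_apply (k : ℕ) (ρ2 : ℝ) (y : Fin k → ℝ) (i : Fin k) :
    (eqCor k ρ2 *ᵥ y) i = ρ2 * ∑ j, y j + (1 - ρ2) * y i := by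
  have hentry : ∀ j, eqCor k ρ2 i j * y j = ρ2 * y j + if i = j then (1 - ρ2) * y j else 0 := by
    intro j
    by_cases hij : i = j <;> simp [eqCor, hij]
    ring
  simp [mulVec, dotProduct, hentry, Finset.sum_add_distrib, Finset.mul_sum]

/-- The quadratic form of the bordered equicorrelation matrix as a combination of squares. -/
theorem borderedEqCor_quadraticForm (k : ℕ) (ρ1 ρ2 : ℝ) (x : Fin (k + 1) → ℝ) :
    x ⬝ᵥ (borderedEqCor k ρ1 ρ2 *ᵥ x) =
      (x 0 + ρ1 * ∑ i : Fin k, x i.succ) ^ 2 + (ρ2 - ρ1 ^ 2) * (∑ i : Fin k, x i.succ) ^ 2 +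
        (1 - ρ2) * ∑ i : Fin k, x i.succ ^ 2 := by
  have hzero : (borderedEqCor k ρ1 ρ2 *ᵥ x) 0 = x 0 + ρ1 * ∑ i : Fin k, x i.succ := by
    simp [mulVec, dotProduct, Fin.sum_univ_succ, borderedEqCor, Finset.mul_sum,
      (Fin.succ_ne_zero _).symm]
  have hsucc : ∀ i : Fin k, (borderedEqCor k ρ1 ρ2 *ᵥ x) i.succ =
      ρ1 * x 0 + (ρ2 * ∑ j : Fin k, x j.succ + (1 - ρ2) * x i.succ) := by
    intro i
    rw [← eqCor_mulVec_apply k ρ2 (fun j => x j.succ) i]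
    simp [mulVec, dotProduct, Fin.sum_univ_succ, borderedEqCor, eqCor]
  have hsum : ∑ i : Fin k, x i.succ * (borderedEqCor k ρ1 ρ2 *ᵥ x) i.succ =
      (∑ i : Fin k, x i.succ) * (ρ1 * x 0 + ρ2 * ∑ j : Fin k, x j.succ) +
        (1 - ρ2) * ∑ i : Fin k, x i.succ ^ 2 := by
    rw [Finset.sum_mul, Finset.mul_sum _ _ (1 - ρ2), ← Finset.sum_add_distrib]
    refine Finset.sum_congr rfl fun i _ => ?_
    rw [hsucc]
    ring
  rw [dotProduct, Fin.sum_univ_succ, hzero, hsum]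
  ring

theorem stmt_10 (ρ1 ρ2 : ℝ) (h1 : -1 < ρ1) (h1' : ρ1 < 1) (h2 : -1 < ρ2) (h2' : ρ2 < 1)
    (h : ρ1 ^ 2 < ρ2) (h' : ρ2 < 1) :
    ∀ k : ℕ, 0 < k → (borderedEqCor k ρ1 ρ2).PosDef := by
  intro k _
  refine posDef_iff_dotProduct_mulVec.mpr ⟨borderedEqCor_isHermitian k ρ1 ρ2, fun x hx => ?_⟩
  rw [star_trivial, borderedEqCor_quadraticForm]
  have hS : 0 ≤ (ρ2 - ρ1 ^ 2) * (∑ i : Fin k, x i.succ) ^ 2 :=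
    mul_nonneg (sub_nonneg.mpr h.le) (sq_nonneg _)
  have hQ0 : 0 ≤ ∑ i : Fin k, x i.succ ^ 2 := Finset.sum_nonneg fun i _ => sq_nonneg _
  by_cases hQ : ∑ i : Fin k, x i.succ ^ 2 = 0
  · have hx' : ∀ i : Fin k, x i.succ = 0 := by
      simpa [Finset.sum_eq_zero_iff_of_nonneg, sq_nonneg] using hQ
    have hx0 : x 0 ≠ 0 := fun h0 => hx (funext (Fin.cases h0 hx'))
    simpa [hx'] using pow_pos (abs_pos.mpr hx0) 2
  · have := mul_pos (sub_pos.mpr h') (lt_of_le_of_ne hQ0 (Ne.symm hQ))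
    positivity
end

section
/- For every positive integer k and all real numbers ρ1, ρ2 with -1 < ρ1 < 1 and -1 < ρ2 < 1, the determinant of the (k+1)×(k+1) bordered autoregressive matrix Σ_{ρ1,ρ2}^{[k,2]} satisfies (1 - ρ2²)·det(Σ_{ρ1,ρ2}^{[k,2]}) = (1 - ρ2²)^{k-1} · [ (1 - ρ2²) - ρ1²·( k - 2(k-1)ρ2 + (k-2)ρ2² ) ]. -/
open Matrix

/-- The k×k autoregressive (AR(1)) correlation matrix with (i,j) entry ρ2^{|i-j|}. -/
def arCor (k : ℕ) (ρ2 : ℝ) : Matrix (Fin k) (Fin k) ℝ :=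
  Matrix.of fun i j => ρ2 ^ ((i : ℤ) - (j : ℤ)).natAbs

/-- The (k+1)×(k+1) bordered autoregressive matrix: top-left entry 1, remaining
first-row/first-column entries ρ1, lower-right k×k block equal to `arCor k ρ2`. -/
def borderedArCor (k : ℕ) (ρ1 ρ2 : ℝ) : Matrix (Fin (k + 1)) (Fin (k + 1)) ℝ :=
  Matrix.of fun i j =>
    if i = 0 ∧ j = 0 then 1
    else if i = 0 ∨ j = 0 then ρ1
    else ρ2 ^ ((i : ℤ) - (j : ℤ)).natAbs

/-- The determinant of an arrowhead matrix with nonzero diagonal entries. -/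
theorem det_arrowhead {K : Type*} [Field K] {n : ℕ} (N : Matrix (Fin (n + 1)) (Fin (n + 1)) K)
    (c d : Fin n → K) (hd : ∀ i, d i ≠ 0) (h00 : N 0 0 = 1)
    (h0 : ∀ j : Fin n, N 0 j.succ = c j) (h1 : ∀ i : Fin n, N i.succ 0 = c i)
    (h : ∀ i j : Fin n, N i.succ j.succ = if i = j then d i else 0) :
    N.det = (∏ i, d i) * (1 - ∑ i, c i ^ 2 / d i) := by
  let E : Matrix (Fin (n + 1)) (Fin (n + 1)) K :=
    Matrix.of fun i j => Fin.cases (if j = 0 then 1 else 0)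
      (fun i' => Fin.cases (-(c i' / d i')) (fun j' => if i' = j' then 1 else 0) j) i
  have hE : E.det = 1 := by
    rw [Matrix.det_of_isLowerTriangular]
    · simp [Fin.prod_univ_succ, E]
    · intro i j hij
      replace hij : i < j := hij
      cases i using Fin.cases <;> cases j using Fin.cases <;>
        simp_all [E, ne_of_lt, Fin.succ_ne_zero]
  have hNE : (N * E).det = (∏ i, d i) * (1 - ∑ i, c i ^ 2 / d i) := by
    rw [Matrix.det_of_isUpperTriangular]
    · rw [Fin.prod_univ_succ, mul_comm]
      congr 1
      · simp [Matrix.mul_apply, Fin.sum_univ_succ, E, h]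
      · simp [Matrix.mul_apply, Fin.sum_univ_succ, E, h00, h0, sub_eq_add_neg,
          mul_div_assoc, pow_two]
    · intro i j hij
      replace hij : j < i := hij
      cases i using Fin.cases with
      | zero => simp at hij
      | succ i =>
        cases j using Fin.cases with
        | zero => simp [Matrix.mul_apply, Fin.sum_univ_succ, E, h, h1, mul_div_cancel₀, hd]
        | succ j =>
          have hne : i ≠ j := (Fin.succ_lt_succ_iff.mp hij).ne'
          simp [Matrix.mul_apply, Fin.sum_univ_succ, E, h, hne]
  rw [← hNE, Matrix.det_mul, hE, mul_one]

/-- The mixed second quasi-difference of `ρ ^ |a - b|` is supported on the diagonal. -/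
theorem pow_natAbs_sub_quasidiff {R : Type*} [CommRing R] (ρ : R) (a b : ℕ) :
    ρ ^ ((a + 1 : ℤ) - (b + 1)).natAbs - ρ * ρ ^ ((a : ℤ) - (b + 1)).natAbs
      - ρ * (ρ ^ ((a + 1 : ℤ) - b).natAbs - ρ * ρ ^ ((a : ℤ) - b).natAbs)
      = if a = b then 1 - ρ ^ 2 else 0 := by
  rcases lt_trichotomy a b with hab | rfl | hab
  · obtain ⟨n, rfl⟩ := Nat.exists_eq_add_of_lt hab
    rw [if_neg hab.ne, show ((a + 1 : ℤ) - ((a + n + 1 : ℕ) + 1)).natAbs = n + 1 by lia,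
      show ((a : ℤ) - ((a + n + 1 : ℕ) + 1)).natAbs = n + 2 by lia,
      show ((a + 1 : ℤ) - (a + n + 1 : ℕ)).natAbs = n by lia,
      show ((a : ℤ) - (a + n + 1 : ℕ)).natAbs = n + 1 by lia]
    ring
  · simp only [if_true, sub_self, Int.natAbs_zero, show ((a : ℤ) - (a + 1)).natAbs = 1 by lia,
      show ((a + 1 : ℤ) - a).natAbs = 1 by lia]
    ring
  · obtain ⟨n, rfl⟩ := Nat.exists_eq_add_of_lt hab
    rw [if_neg hab.ne', show (((b + n + 1 : ℕ) + 1 : ℤ) - (b + 1)).natAbs = n + 1 by lia,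
      show (((b + n + 1 : ℕ) : ℤ) - (b + 1)).natAbs = n by lia,
      show (((b + n + 1 : ℕ) + 1 : ℤ) - b).natAbs = n + 2 by lia,
      show (((b + n + 1 : ℕ) : ℤ) - b).natAbs = n + 1 by lia]
    ring

theorem stmt_14 (k : ℕ) (hk : 0 < k) (ρ1 ρ2 : ℝ)
    (h1 : -1 < ρ1) (h1' : ρ1 < 1) (h2 : -1 < ρ2) (h2' : ρ2 < 1) :
    (1 - ρ2 ^ 2) * (borderedArCor k ρ1 ρ2).det
      = (1 - ρ2 ^ 2) ^ (k - 1) *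
          ((1 - ρ2 ^ 2)
            - ρ1 ^ 2 * ((k : ℝ) - 2 * ((k : ℝ) - 1) * ρ2 + ((k : ℝ) - 2) * ρ2 ^ 2)) := by
  obtain ⟨m, rfl⟩ := Nat.exists_eq_succ_of_ne_zero hk.ne'
  have hρ : 1 - ρ2 ^ 2 ≠ 0 := by nlinarith
  set M := borderedArCor (m + 1) ρ1 ρ2
  let e : Fin (m + 1) → ℝ := Fin.cons 0 fun _ => ρ2
  let B : Matrix (Fin (m + 2)) (Fin (m + 2)) ℝ := Matrix.of fun i j =>
    M i j - Fin.cases 0 (fun i' => e i' * M i'.castSucc j) i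
  let N : Matrix (Fin (m + 2)) (Fin (m + 2)) ℝ := Matrix.of fun i j =>
    B i j - Fin.cases 0 (fun j' => e j' * B i j'.castSucc) j
  have hMB : M.det = B.det :=
    Matrix.det_eq_of_forall_row_eq_smul_add_pred e (by simp [B]) (by simp [B])
  have hBN : B.det = N.det :=
    Matrix.det_eq_of_forall_col_eq_smul_add_pred e (by simp [N]) (by simp [N])
  have M00 : M 0 0 = 1 := by simp [M, borderedArCor]
  have M0s (j) : M 0 (Fin.succ j) = ρ1 := by simp [M, borderedArCor]
  have Ms0 (i) : M (Fin.succ i) 0 = ρ1 := by simp [M, borderedArCor]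
  have Mss (i j) : M (Fin.succ i) (Fin.succ j) = ρ2 ^ ((i : ℤ) - (j : ℤ)).natAbs := by
    simp [M, borderedArCor]
  have B0 (j) : B 0 j = M 0 j := sub_zero _
  have Bs (i j) : B (Fin.succ i) j = M i.succ j - e i * M i.castSucc j := rfl
  have N0 (i) : N i 0 = B i 0 := sub_zero _
  have Ns (i j) : N i (Fin.succ j) = B i j.succ - e j * B i j.castSucc := rfl
  have e0 : e 0 = 0 := rfl
  have es (i) : e (Fin.succ i) = ρ2 := rfl
  have hN : N.det = _ := det_arrowhead N (Fin.cons ρ1 fun _ => ρ1 * (1 - ρ2))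
    (Fin.cons 1 fun _ => 1 - ρ2 ^ 2) (Fin.cases (by simp) fun _ => by simpa using hρ)
    (by rw [N0, B0, M00])
    (by
      intro j
      cases j using Fin.cases <;>
        simp only [Ns, B0, M0s, e0, es, ← Fin.succ_castSucc, Fin.cons_zero, Fin.cons_succ] <;>
        ring)
    (by
      intro i
      cases i using Fin.cases <;>
        simp only [N0, Bs, Ms0, e0, es, ← Fin.succ_castSucc, Fin.cons_zero, Fin.cons_succ] <;>
        ring)
    (by
      intro i j
      cases i using Fin.cases with
      | zero =>
        cases j using Fin.cases with
        | zero => simp only [Ns, Bs, Mss, e0, sub_self, Int.natAbs_zero, zero_mul, sub_zero, pow_zero,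
            if_true, Fin.cons_zero]
        | succ j =>
          have hj : ((0 : ℤ) - ((j : ℤ) + 1)).natAbs = (j : ℕ) + 1 := by omega
          have hj' : ((0 : ℤ) - (j : ℤ)).natAbs = j := by omega
          rw [if_neg (Fin.succ_ne_zero j).symm]
          simp only [Ns, Bs, Mss, e0, es, ← Fin.succ_castSucc, Fin.val_zero, Fin.val_succ,
            Fin.val_castSucc, Nat.cast_add, Nat.cast_one, Nat.cast_zero, hj, hj']
          ring
      | succ i =>
        cases j using Fin.cases with
        | zero =>
          have hi : ((i : ℤ) + 1 - 0).natAbs = (i : ℕ) + 1 := by omega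
          have hi' : ((i : ℤ) - 0).natAbs = i := by omega
          rw [if_neg (Fin.succ_ne_zero i)]
          simp only [Ns, Bs, Mss, e0, es, ← Fin.succ_castSucc, Fin.val_zero, Fin.val_succ,
            Fin.val_castSucc, Nat.cast_add, Nat.cast_one, Nat.cast_zero, hi, hi']
          ring
        | succ j =>
          have := pow_natAbs_sub_quasidiff ρ2 i j
          simp only [Ns, Bs, Mss, es, ← Fin.succ_castSucc, Fin.val_succ, Fin.val_castSucc,
            Nat.add_right_cancel_iff, Fin.cons_succ, Fin.ext_iff, Nat.cast_add, Nat.cast_one]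
          linear_combination this)
  rw [hMB, hBN, hN]
  simp only [Fin.prod_univ_succ, Fin.sum_univ_succ, Fin.cons_zero, Fin.cons_succ,
    Finset.prod_const, Finset.sum_const, Finset.card_univ, Fintype.card_fin, nsmul_eq_mul,
    Nat.succ_eq_add_one, Nat.add_sub_cancel]
  push_cast
  field_simp
  ring
end

section
/- Let k be a positive integer, ρ2 ∈ (-1,1), and let 1_k denote the column vector of ones in ℝ^k. Then 1_kᵀ · (Σ_{ρ2}^{[k,2]})^{-1} · 1_k = ( k - 2(k-1)ρ2 + (k-2)ρ2² ) / (1 - ρ2²). -/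
open Matrix

theorem det_arCor_succ (n : ℕ) (r : ℝ) : (arCor (n + 1) r).det = (1 - r ^ 2) ^ n := by
  let B : Matrix (Fin (n + 1)) (Fin (n + 1)) ℝ :=
    Matrix.of fun i j => Fin.cases (arCor (n + 1) r 0 j)
      (fun i => arCor (n + 1) r i.succ j - r * arCor (n + 1) r i.castSucc j) i
  have hB : (arCor (n + 1) r).det = B.det :=
    det_eq_of_forall_row_eq_smul_add_pred (fun _ => r) (fun j => rfl) (fun i j => by simp [B])
  have hT : B.BlockTriangular id := by
    intro i j hij
    induction i using Fin.cases with
    | zero => exact absurd hij (Fin.not_lt_zero j)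
    | succ i =>
      have hj : (j : ℕ) ≤ i := by
        have : (j : ℕ) < i.succ := hij
        simp at this
        omega
      have e : ((i : ℤ) + 1 - (j : ℤ)).natAbs = ((i : ℤ) - (j : ℤ)).natAbs + 1 := by omega
      simp [B, arCor, e, pow_succ']
  rw [hB, det_of_isUpperTriangular hT, Fin.prod_univ_succ]
  simp [B, arCor, ← sq]

theorem one_sub_mul_sum_range_pow_natAbs (r : ℝ) (i m : ℕ) (h : i + 1 ≤ m) :
    (1 - r) * ∑ j ∈ Finset.range m, r ^ ((i : ℤ) - (j : ℤ)).natAbs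
      = 1 + r - r ^ (i + 1) - r ^ (m - i) := by
  induction m, h using Nat.le_induction with
  | base =>
    have e : ∑ j ∈ Finset.range (i + 1), r ^ ((i : ℤ) - (j : ℤ)).natAbs
        = ∑ j ∈ Finset.range (i + 1), r ^ j := by
      rw [← Finset.sum_range_reflect (fun j => r ^ j)]
      refine Finset.sum_congr rfl fun j hj => ?_
      have := Finset.mem_range.1 hj
      congr 1
      omega
    rw [e, mul_neg_geom_sum, Nat.add_sub_cancel_left]
    ring
  | succ m hm ih =>
    have e1 : ((i : ℤ) - (m : ℤ)).natAbs = m - i := by omega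
    have e2 : m + 1 - i = (m - i) + 1 := by omega
    rw [Finset.sum_range_succ, mul_add, ih, e1, e2, pow_succ r (m - i)]
    ring

theorem arCor_succ_mulVec (n : ℕ) (r : ℝ) (hr : 1 + r ≠ 0) :
    arCor (n + 1) r *ᵥ (fun i => ((1 - r) + (if i = 0 then r else 0)
      + (if i = Fin.last n then r else 0)) / (1 + r)) = fun _ => 1 := by
  funext i
  have hs := one_sub_mul_sum_range_pow_natAbs r i (n + 1) i.isLt
  rw [Finset.sum_range, Finset.mul_sum] at hs
  have e1 : ((i : ℤ) - (n : ℤ)).natAbs = n - i := by omega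
  have e2 : n + 1 - (i : ℕ) = (n - i) + 1 := by omega
  simp only [mulVec, dotProduct, arCor, of_apply, mul_div_assoc', ← Finset.sum_div, mul_add,
    Finset.sum_add_distrib, mul_ite, mul_zero, Finset.sum_ite_eq', Finset.mem_univ, if_true]
  rw [div_eq_one_iff_eq hr]
  simp only [mul_comm _ (1 - r), hs, Fin.val_zero, Fin.val_last, e1, e2, Nat.cast_zero, sub_zero,
    Int.natAbs_natCast]
  ring

theorem stmt_17 (k : ℕ) (hk : 0 < k) (ρ2 : ℝ) (h1 : -1 < ρ2) (h2 : ρ2 < 1) :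
    (fun _ : Fin k => (1 : ℝ)) ⬝ᵥ ((arCor k ρ2)⁻¹ *ᵥ fun _ : Fin k => (1 : ℝ))
      = ((k : ℝ) - 2 * ((k : ℝ) - 1) * ρ2 + ((k : ℝ) - 2) * ρ2 ^ 2) / (1 - ρ2 ^ 2) := by
  obtain ⟨n, rfl⟩ := Nat.exists_eq_succ_of_ne_zero hk.ne'
  have hp : 1 + ρ2 ≠ 0 := by linarith
  have hq : 1 - ρ2 ^ 2 ≠ 0 := by nlinarith
  have hdet : IsUnit (arCor (n + 1) ρ2).det := by
    rw [det_arCor_succ]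
    exact (pow_ne_zero n hq).isUnit
  rw [Nat.succ_eq_add_one, ← arCor_succ_mulVec n ρ2 hp, mulVec_mulVec, nonsing_inv_mul _ hdet,
    one_mulVec, arCor_succ_mulVec n ρ2 hp]
  simp only [dotProduct, one_mul, ← Finset.sum_div, Finset.sum_add_distrib, Finset.sum_ite_eq',
    Finset.mem_univ, if_true, Finset.sum_const, Finset.card_univ, Fintype.card_fin, nsmul_eq_mul]
  rw [div_eq_div_iff hp hq]
  push_cast
  ring
end

section
/- Let k be a positive integer and ρ1, ρ2 ∈ (-1,1). The (k+1)×(k+1) bordered autoregressive matrix Σ_{ρ1,ρ2}^{[k,2]} is positive definite if and only if ρ2²·((k-2)ρ1² + 1) - 2(k-1)ρ1²ρ2 + k·ρ1² - 1 < 0. -/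
open Matrix

theorem sum_range_autoregressive (r : ℝ) (n : ℕ) :
    ∑ l ∈ Finset.range (n + 1), (if l = 0 then 1 else 1 - r) * r ^ (n - l) = 1 := by
  induction n with
  | zero => simp
  | succ n ih =>
    rw [Finset.sum_range_succ]
    have h : ∑ l ∈ Finset.range (n + 1), (if l = 0 then 1 else 1 - r) * r ^ (n + 1 - l)
        = r * ∑ l ∈ Finset.range (n + 1), (if l = 0 then 1 else 1 - r) * r ^ (n - l) := by
      rw [Finset.mul_sum]
      refine Finset.sum_congr rfl fun l hl => ?_
      have hl' : l ≤ n := Nat.lt_succ_iff.mp (Finset.mem_range.mp hl)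
      rw [Nat.succ_sub hl', pow_succ]
      ring
    rw [h, ih]
    simp

theorem Fin.sum_univ_ite_le {k j : ℕ} (hj : j < k) (f : ℕ → ℝ) :
    ∑ l : Fin k, (if (l : ℕ) ≤ j then f l else 0) = ∑ l ∈ Finset.range (j + 1), f l := by
  rw [Fin.sum_univ_eq_sum_range (fun l => if l ≤ j then f l else 0) k, ← Finset.sum_filter]
  refine Finset.sum_congr ?_ fun _ _ => rfl
  ext l
  simp only [Finset.mem_filter, Finset.mem_range]
  omega

/-- The innovation factor of the AR(1) correlation matrix. -/
def arFactor (k : ℕ) (r : ℝ) : Matrix (Fin k) (Fin k) ℝ :=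
  Matrix.of fun i l => if (l : ℕ) ≤ i then r ^ ((i : ℕ) - l) else 0

/-- The innovation variances of the AR(1) correlation matrix. -/
def arVariance (r : ℝ) (l : ℕ) : ℝ := if l = 0 then 1 else 1 - r ^ 2

/-- The regression coefficients of the border on the innovations. -/
noncomputable def borderCoeff (a r : ℝ) (l : ℕ) : ℝ := if l = 0 then a else a / (1 + r)

/-- The factor in the diagonalising factorisation of the bordered autoregressive matrix. -/
noncomputable def borderedFactor (k : ℕ) (a r : ℝ) : Matrix (Fin (k + 1)) (Fin (k + 1)) ℝ :=
  Matrix.of <| Fin.cons (Fin.cons 1 fun l => borderCoeff a r l)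
    fun i => Fin.cons 0 (arFactor k r i)

/-- The pivots of the bordered autoregressive matrix. -/
noncomputable def borderedPivot (k : ℕ) (a r : ℝ) : Fin (k + 1) → ℝ :=
  Fin.cons (1 - ∑ l : Fin k, borderCoeff a r l ^ 2 * arVariance r l) fun l => arVariance r l

theorem det_arFactor (k : ℕ) (r : ℝ) : (arFactor k r).det = 1 := by
  rw [Matrix.det_of_isLowerTriangular]
  · simp [arFactor]
  · intro i j hij
    exact if_neg (not_le.mpr hij)

theorem det_borderedFactor (k : ℕ) (a r : ℝ) : (borderedFactor k a r).det = 1 := by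
  rw [Matrix.det_succ_column_zero, Fin.sum_univ_succ]
  have h : (borderedFactor k a r).submatrix (Fin.succAbove 0) Fin.succ = arFactor k r := by
    ext i j
    simp [borderedFactor]
  rw [h, det_arFactor]
  simp [borderedFactor]

theorem sum_arFactor_of_le {k : ℕ} (r : ℝ) {i j : Fin k} (hij : i ≤ j) :
    ∑ l, arFactor k r i l * arVariance r l * arFactor k r j l = r ^ ((j : ℕ) - i) := by
  have hij' : (i : ℕ) ≤ j := hij
  have h := Fin.sum_univ_ite_le i.2
    fun l => r ^ ((j : ℕ) - i) * ((if l = 0 then 1 else 1 - r ^ 2) * (r ^ 2) ^ ((i : ℕ) - l))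
  rw [← Finset.mul_sum, sum_range_autoregressive, mul_one] at h
  rw [← h]
  refine Finset.sum_congr rfl fun l _ => ?_
  by_cases hl : (l : ℕ) ≤ i
  · have hjl : (j : ℕ) - l = (j - i) + (i - l) := by omega
    simp only [arFactor, arVariance, Matrix.of_apply, if_pos hl, if_pos (hl.trans hij'), hjl,
      pow_add]
    ring
  · simp only [arFactor, Matrix.of_apply, if_neg hl, zero_mul]

theorem sum_arFactor {k : ℕ} (r : ℝ) (i j : Fin k) :
    ∑ l, arFactor k r i l * arVariance r l * arFactor k r j l
      = r ^ ((i : ℤ) - (j : ℤ)).natAbs := by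
  rcases le_total i j with h | h
  · have h' : (i : ℕ) ≤ j := h
    rw [sum_arFactor_of_le r h]
    congr 1
    omega
  · have h' : (j : ℕ) ≤ i := h
    have hc : ∑ l, arFactor k r i l * arVariance r l * arFactor k r j l
        = ∑ l, arFactor k r j l * arVariance r l * arFactor k r i l :=
      Finset.sum_congr rfl fun l _ => by ring
    rw [hc, sum_arFactor_of_le r h]
    congr 1
    omega

theorem sum_borderCoeff_mul_arFactor {k : ℕ} (a : ℝ) {r : ℝ} (hr : 1 + r ≠ 0) (j : Fin k) :
    ∑ l : Fin k, borderCoeff a r l * arVariance r l * arFactor k r j l = a := by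
  have h := Fin.sum_univ_ite_le j.2
    fun l => a * ((if l = 0 then 1 else 1 - r) * r ^ ((j : ℕ) - l))
  rw [← Finset.mul_sum, sum_range_autoregressive, mul_one] at h
  refine Eq.trans (Finset.sum_congr rfl fun l _ => ?_) h
  by_cases hl : (l : ℕ) ≤ j
  · by_cases h0 : (l : ℕ) = 0
    · simp only [arFactor, arVariance, borderCoeff, Matrix.of_apply, if_pos hl, if_pos h0, mul_one,
        one_mul]
    · simp only [arFactor, arVariance, borderCoeff, Matrix.of_apply, if_pos hl, if_neg h0]
      field_simp
      ring
  · simp only [arFactor, Matrix.of_apply, if_neg hl, mul_zero]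

theorem borderedArCor_eq_factor (k : ℕ) (a : ℝ) {r : ℝ} (hr : 1 + r ≠ 0) :
    borderedArCor k a r
      = borderedFactor k a r * diagonal (borderedPivot k a r) * star (borderedFactor k a r) := by
  ext i j
  rw [Matrix.mul_apply]
  simp only [Matrix.mul_diagonal, Matrix.star_apply, star_trivial]
  rw [Fin.sum_univ_succ]
  refine Fin.cases ?_ (fun i => ?_) i <;> refine Fin.cases ?_ (fun j => ?_) j
  · have h : ∑ l : Fin k, borderCoeff a r l * arVariance r l * borderCoeff a r l
        = ∑ l : Fin k, borderCoeff a r l ^ 2 * arVariance r l :=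
      Finset.sum_congr rfl fun l _ => by ring
    simp [borderedArCor, borderedFactor, borderedPivot, h]
  · simp [borderedArCor, borderedFactor, borderedPivot, sum_borderCoeff_mul_arFactor a hr]
  · have h : ∑ l : Fin k, arFactor k r i l * arVariance r l * borderCoeff a r l = a :=
      (Finset.sum_congr rfl fun l _ => by ring).trans (sum_borderCoeff_mul_arFactor a hr i)
    simp [borderedArCor, borderedFactor, borderedPivot, h]
  · simp [borderedArCor, borderedFactor, borderedPivot, sum_arFactor]

theorem posDef_borderedArCor_iff_pivot (k : ℕ) (a : ℝ) {r : ℝ} (hr : 1 + r ≠ 0) :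
    (borderedArCor k a r).PosDef ↔ ∀ i, 0 < borderedPivot k a r i := by
  have hU : IsUnit (borderedFactor k a r) := by
    rw [Matrix.isUnit_iff_isUnit_det, det_borderedFactor]
    exact isUnit_one
  rw [borderedArCor_eq_factor k a hr, hU.posDef_star_right_conjugate_iff,
    Matrix.posDef_diagonal_iff]

theorem stmt_18 (k : ℕ) (hk : 0 < k) (ρ1 ρ2 : ℝ)
    (h1 : -1 < ρ1) (h1' : ρ1 < 1) (h2 : -1 < ρ2) (h2' : ρ2 < 1) :
    (borderedArCor k ρ1 ρ2).PosDef
      ↔ ρ2 ^ 2 * (((k : ℝ) - 2) * ρ1 ^ 2 + 1) - 2 * ((k : ℝ) - 1) * ρ1 ^ 2 * ρ2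
          + (k : ℝ) * ρ1 ^ 2 - 1 < 0 := by
  have hr : 0 < 1 + ρ2 := by linarith
  have hv : 0 < 1 - ρ2 ^ 2 := by nlinarith
  have hvar (l : ℕ) : 0 < arVariance ρ2 l := by
    unfold arVariance
    split_ifs <;> linarith
  obtain ⟨n, rfl⟩ := Nat.exists_eq_add_of_lt hk
  rw [posDef_borderedArCor_iff_pivot _ _ hr.ne', Fin.forall_fin_succ]
  simp only [borderedPivot, Fin.cons_zero, Fin.cons_succ, hvar, implies_true, and_true]
  have hs : ∑ l : Fin (0 + n + 1), borderCoeff ρ1 ρ2 l ^ 2 * arVariance ρ2 l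
      = ρ1 ^ 2 + n * ((ρ1 / (1 + ρ2)) ^ 2 * (1 - ρ2 ^ 2)) := by
    rw [Fin.sum_univ_succ]
    simp [borderCoeff, arVariance]
  rw [hs, ← mul_pos_iff_of_pos_left hv, ← neg_pos (a := _ - 1)]
  have he : (1 - ρ2 ^ 2) * (1 - (ρ1 ^ 2 + n * ((ρ1 / (1 + ρ2)) ^ 2 * (1 - ρ2 ^ 2))))
      = -(ρ2 ^ 2 * ((((0 + n + 1 : ℕ) : ℝ) - 2) * ρ1 ^ 2 + 1)
          - 2 * (((0 + n + 1 : ℕ) : ℝ) - 1) * ρ1 ^ 2 * ρ2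
          + ((0 + n + 1 : ℕ) : ℝ) * ρ1 ^ 2 - 1) := by
    push_cast
    field_simp
    ring
  rw [he]
end
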